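/- arXiv:quant-ph/0304127 — 2 statements merged into one kernel-verified Lean document; each statement's English description precedes it below -/
import Mathlib

section
/- Index ℂ⁴ by {1,2,3,4}, let Π₁₂ be the orthogonal projection onto span{|1⟩,|2⟩} and Π₃₄ the orthogonal projection onto span{|3⟩,|4⟩}, and set π₁₂ = Π₁₂/2 and π₃₄ = Π₃₄/2. Define the quantum channel N on 4×4 complex matrices by N(ρ) = Π₁₂ ρ Π₁₂ + Tr(Π₃₄ ρ Π₃₄)·π₃₄. Let |Φ⟩ = (|1⟩⊗|1⟩ + |2⟩⊗|2⟩)/√2 ∈ ℂ⁴⊗ℂ⁴, a purification of π₁₂, and let Ω = (id ⊗ N)(|Φ⟩⟨Φ|) be the 16×16 matrix obtained by applying N to the second tensor factor, i.e. Ω_{(r,q),(r',q')} = [q∈{1,2}][q'∈{1,2}]·M_{(r,q),(r',q')} + [q = q' ∈ {3,4}]·(1/2)·∑_{p∈{3,4}} M_{(r,p),(r',p)} with M = |Φ⟩⟨Φ|. Then the coherent information I_c(π₁₂, N) = H(N(π₁₂)) - H(Ω) equals 1. -/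
open Matrix
open scoped ComplexOrder BigOperators

/-- The von Neumann entropy (base 2) of a Hermitian matrix, computed from its
eigenvalues (junk value `0` if the matrix is not Hermitian). -/
noncomputable def vNEntropy {ι : Type*} [Fintype ι] [DecidableEq ι]
    (A : Matrix ι ι ℂ) : ℝ :=
  open scoped Classical in
  if h : A.IsHermitian then -∑ i, h.eigenvalues i * Real.logb 2 (h.eigenvalues i) else 0

/-- The projection onto the span of the first two basis vectors of `ℂ⁴`. -/
def P12 : Matrix (Fin 4) (Fin 4) ℂ := Matrix.diagonal fun i => if i.1 < 2 then 1 else 0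

/-- The projection onto the span of the last two basis vectors of `ℂ⁴`. -/
def P34 : Matrix (Fin 4) (Fin 4) ℂ := Matrix.diagonal fun i => if 2 ≤ i.1 then 1 else 0

/-- The maximally mixed state on the first two-dimensional subspace. -/
noncomputable def pi12 : Matrix (Fin 4) (Fin 4) ℂ := (2 : ℂ)⁻¹ • P12

/-- The maximally mixed state on the second two-dimensional subspace. -/
noncomputable def pi34 : Matrix (Fin 4) (Fin 4) ℂ := (2 : ℂ)⁻¹ • P34

/-- The channel `N(ρ) = Π₁₂ ρ Π₁₂ + Tr(Π₃₄ ρ Π₃₄)·π₃₄` of Appendix C of the paper. -/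
noncomputable def chanN (ρ : Matrix (Fin 4) (Fin 4) ℂ) : Matrix (Fin 4) (Fin 4) ℂ :=
  P12 * ρ * P12 + ((P34 * ρ * P34).trace) • pi34

/-- The purification `|Φ⟩ = (|1⟩⊗|1⟩ + |2⟩⊗|2⟩)/√2` of `π₁₂`, as a vector in `ℂ⁴ ⊗ ℂ⁴`. -/
noncomputable def Phi12 : Fin 4 × Fin 4 → ℂ :=
  fun p => if p.1 = p.2 ∧ p.1.1 < 2 then ((Real.sqrt 2 : ℝ) : ℂ)⁻¹ else 0

/-- The rank-one projector `M = |Φ⟩⟨Φ|`. -/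
noncomputable def M12 : Matrix (Fin 4 × Fin 4) (Fin 4 × Fin 4) ℂ :=
  Matrix.of fun a b => Phi12 a * star (Phi12 b)

/-- `Ω = (id ⊗ N)(|Φ⟩⟨Φ|)`, written entrywise. -/
noncomputable def Omega12 : Matrix (Fin 4 × Fin 4) (Fin 4 × Fin 4) ℂ :=
  Matrix.of fun a b =>
    (if a.2.1 < 2 ∧ b.2.1 < 2 then M12 a b else 0) +
    (if a.2 = b.2 ∧ 2 ≤ a.2.1 then
      (2 : ℂ)⁻¹ * ∑ p : Fin 4, (if 2 ≤ p.1 then M12 (a.1, p) (b.1, p) else 0) else 0)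

/-- Every eigenvalue of a Hermitian matrix with `A * A = c • A` is a root of `x * x = c * x`. -/
theorem Matrix.IsHermitian.eigenvalues_mul_self_of_mul_self_eq_smul {ι : Type*} [Fintype ι]
    [DecidableEq ι] {A : Matrix ι ι ℂ} (hA : A.IsHermitian) {c : ℝ} (h : A * A = (c : ℂ) • A)
    (i : ι) : hA.eigenvalues i * hA.eigenvalues i = c * hA.eigenvalues i := by
  have hv := hA.mulVec_eigenvectorBasis i
  have hne : (hA.eigenvectorBasis i).ofLp ≠ 0 := fun h0 =>
    hA.eigenvectorBasis.orthonormal.ne_zero i ((WithLp.ofLp_eq_zero 2).1 h0)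
  obtain ⟨j, hj⟩ := Function.ne_iff.1 hne
  have key := congrFun (congrArg (· *ᵥ (hA.eigenvectorBasis i).ofLp) h) j
  simp only [← Matrix.mulVec_mulVec, Matrix.smul_mulVec, hv, Matrix.mulVec_smul, Pi.smul_apply,
    Complex.real_smul, smul_eq_mul, ← mul_assoc] at key
  exact_mod_cast mul_right_cancel₀ hj key

/-- A Hermitian matrix with `A * A = c • A` has entropy `-Tr A * log₂ c`. -/
theorem vNEntropy_of_mul_self_eq_smul {ι : Type*} [Fintype ι] [DecidableEq ι]
    {A : Matrix ι ι ℂ} (hA : A.IsHermitian) {c : ℝ} (h : A * A = (c : ℂ) • A) :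
    vNEntropy A = -(A.trace.re * Real.logb 2 c) := by
  rw [vNEntropy, dif_pos hA, hA.trace_eq_sum_eigenvalues, Complex.re_sum, Finset.sum_mul]
  congr 1
  refine Finset.sum_congr rfl fun i _ => ?_
  rcases eq_or_ne (hA.eigenvalues i) 0 with h0 | h0
  · simp [h0]
  · simp [mul_right_cancel₀ h0 (hA.eigenvalues_mul_self_of_mul_self_eq_smul h i)]

theorem chanN_pi12 : chanN pi12 = pi12 := by
  ext i j
  fin_cases i <;> fin_cases j <;>
    simp [chanN, pi12, pi34, P12, P34, Matrix.trace, Fin.sum_univ_four]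

theorem isHermitian_pi12 : pi12.IsHermitian := by
  ext i j
  fin_cases i <;> fin_cases j <;> simp [pi12, P12]

theorem pi12_mul_self : pi12 * pi12 = (((2 : ℝ)⁻¹ : ℝ) : ℂ) • pi12 := by
  ext i j
  fin_cases i <;> fin_cases j <;> simp [pi12, P12]

theorem trace_pi12 : pi12.trace = 1 := by
  simp [pi12, P12, Matrix.trace, Fin.sum_univ_four]
  norm_num

theorem Phi12_eq_zero {r q : Fin 4} (hq : 2 ≤ q.1) : Phi12 (r, q) = 0 := by
  refine if_neg ?_
  rintro ⟨h, hr⟩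
  dsimp only at h hr
  omega

theorem Omega12_eq : Omega12 = Matrix.vecMulVec Phi12 (star Phi12) := by
  ext ⟨r, q⟩ ⟨r', q'⟩
  have hs : ∑ p : Fin 4, (if 2 ≤ p.1 then M12 (r, p) (r', p) else 0) = 0 :=
    Finset.sum_eq_zero fun p _ => by
      split_ifs with hp
      · simp [M12, Phi12_eq_zero hp]
      · rfl
  simp only [Omega12, Matrix.of_apply, hs, mul_zero, ite_self, add_zero]
  split_ifs with h
  · rfl
  · rcases not_and_or.1 h with hq | hq <;>
      simp [Matrix.vecMulVec_apply, Phi12_eq_zero (not_lt.1 hq)]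

theorem star_Phi12_dotProduct_Phi12 : star Phi12 ⬝ᵥ Phi12 = 1 := by
  have h : ((Real.sqrt 2 : ℝ) : ℂ)⁻¹ * ((Real.sqrt 2 : ℝ) : ℂ)⁻¹ = 2⁻¹ := by
    rw [← mul_inv]
    norm_cast
    rw [Real.mul_self_sqrt zero_le_two]
    norm_num
  simp [dotProduct, Phi12, Fintype.sum_prod_type, Fin.sum_univ_four, h, ← two_mul]

theorem vNEntropy_Omega12 : vNEntropy Omega12 = 0 := by
  have hH : Omega12.IsHermitian := by
    rw [Omega12_eq]
    exact (Matrix.posSemidef_vecMulVec_self_star Phi12).isHermitian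
  have hI : Omega12 * Omega12 = ((1 : ℝ) : ℂ) • Omega12 := by
    rw [Omega12_eq, Matrix.vecMulVec_mul_vecMulVec, star_Phi12_dotProduct_Phi12]
    simp
  simp [vNEntropy_of_mul_self_eq_smul hH hI]

/-- **Appendix C of the paper:** the coherent information of `π₁₂` through the channel
`N` equals `1`. -/
theorem coherent_info_pi12 :
    vNEntropy (chanN pi12) - vNEntropy Omega12 = 1 := by
  rw [vNEntropy_Omega12, chanN_pi12, vNEntropy_of_mul_self_eq_smul isHermitian_pi12 pi12_mul_self,
    trace_pi12]
  simp [Real.logb_inv]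
end

section
/- Index ℂ⁴ by {1,2,3,4}, let Π₁₂ be the orthogonal projection onto span{|1⟩,|2⟩} and Π₃₄ the orthogonal projection onto span{|3⟩,|4⟩}, and set π₁₂ = Π₁₂/2 and π₃₄ = Π₃₄/2. Define the quantum channel N on 4×4 complex matrices by N(ρ) = Π₁₂ ρ Π₁₂ + Tr(Π₃₄ ρ Π₃₄)·π₃₄. Let |Φ⟩ = (|3⟩⊗|3⟩ + |4⟩⊗|4⟩)/√2 ∈ ℂ⁴⊗ℂ⁴, a purification of π₃₄, and let Ω = (id ⊗ N)(|Φ⟩⟨Φ|) be the 16×16 matrix obtained by applying N to the second tensor factor, i.e. Ω_{(r,q),(r',q')} = [q∈{1,2}][q'∈{1,2}]·M_{(r,q),(r',q')} + [q = q' ∈ {3,4}]·(1/2)·∑_{p∈{3,4}} M_{(r,p),(r',p)} with M = |Φ⟩⟨Φ|. Then the coherent information I_c(π₃₄, N) = H(N(π₃₄)) - H(Ω) equals -1. -/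
open Matrix
open scoped ComplexOrder BigOperators

/-- The purification `|Φ⟩ = (|3⟩⊗|3⟩ + |4⟩⊗|4⟩)/√2` of `π₃₄`, as a vector in `ℂ⁴ ⊗ ℂ⁴`. -/
noncomputable def Phi34 : Fin 4 × Fin 4 → ℂ :=
  fun p => if p.1 = p.2 ∧ 2 ≤ p.1.1 then ((Real.sqrt 2 : ℝ) : ℂ)⁻¹ else 0

/-- The rank-one projector `M = |Φ⟩⟨Φ|`. -/
noncomputable def M34 : Matrix (Fin 4 × Fin 4) (Fin 4 × Fin 4) ℂ :=
  Matrix.of fun a b => Phi34 a * star (Phi34 b)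

/-- `Ω = (id ⊗ N)(|Φ⟩⟨Φ|)`, written entrywise. -/
noncomputable def Omega34 : Matrix (Fin 4 × Fin 4) (Fin 4 × Fin 4) ℂ :=
  Matrix.of fun a b =>
    (if a.2.1 < 2 ∧ b.2.1 < 2 then M34 a b else 0) +
    (if a.2 = b.2 ∧ 2 ≤ a.2.1 then
      (2 : ℂ)⁻¹ * ∑ p : Fin 4, (if 2 ≤ p.1 then M34 (a.1, p) (b.1, p) else 0) else 0)

/-- The entropy of a real diagonal matrix is the Shannon entropy of its diagonal. -/
theorem vNEntropy_diagonal {ι : Type*} [Fintype ι] [DecidableEq ι] (d : ι → ℝ) :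
    vNEntropy (diagonal fun i => (d i : ℂ)) = -∑ i, d i * Real.logb 2 (d i) := by
  have hA : (diagonal fun i => (d i : ℂ)).IsHermitian := by
    refine isHermitian_diagonal_of_self_adjoint _ ?_
    ext i
    simp
  have hroots := hA.roots_charpoly_eq_eigenvalues
  rw [charpoly_diagonal, Polynomial.roots_prod _ _
    (Finset.prod_ne_zero_iff.mpr fun i _ => Polynomial.X_sub_C_ne_zero _)] at hroots
  simp only [Polynomial.roots_X_sub_C, Multiset.bind_singleton] at hroots
  have hre := congrArg
    (fun s => (s.map fun z : ℂ => z.re * Real.logb 2 z.re).sum) hroots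
  simp only [Multiset.map_map, Function.comp_def, Complex.ofReal_re] at hre
  rw [vNEntropy, dif_pos hA]
  exact congrArg Neg.neg hre.symm

/-- The channel fixes the maximally mixed state on the second subspace. -/
theorem chanN_pi34 :
    chanN pi34 = diagonal fun i : Fin 4 => ((if 2 ≤ i.1 then 1 / 2 else 0 : ℝ) : ℂ) := by
  ext i j
  fin_cases i <;> fin_cases j <;>
    simp [chanN, pi34, P12, P34, diagonal_mul_diagonal, trace, Fin.sum_univ_four] <;> norm_num

theorem M34_apply (r q r' q' : Fin 4) :
    M34 (r, q) (r', q') =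
      if (r = q ∧ 2 ≤ r.1) ∧ (r' = q' ∧ 2 ≤ r'.1) then 2⁻¹ else 0 := by
  have hsqrt : ((Real.sqrt 2 : ℝ) : ℂ)⁻¹ * ((Real.sqrt 2 : ℝ) : ℂ)⁻¹ = 2⁻¹ := by
    rw [← mul_inv, ← Complex.ofReal_mul, Real.mul_self_sqrt (by norm_num)]
    norm_num
  simp only [M34, Phi34, of_apply, ite_and]
  split_ifs <;> simp [hsqrt]

/-- Tracing the second subspace out of `|Φ⟩⟨Φ|` leaves the maximally mixed state on it. -/
theorem sum_M34_apply (r r' : Fin 4) :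
    (∑ p : Fin 4, if 2 ≤ p.1 then M34 (r, p) (r', p) else 0) =
      if r = r' ∧ 2 ≤ r.1 then 2⁻¹ else 0 := by
  simp only [M34_apply, Fin.sum_univ_four]
  fin_cases r <;> fin_cases r' <;> simp

/-- The joint output state is maximally mixed on the tensor square of the second subspace. -/
theorem Omega34_eq_diagonal :
    Omega34 = diagonal fun a : Fin 4 × Fin 4 =>
      ((if 2 ≤ a.1.1 ∧ 2 ≤ a.2.1 then 1 / 4 else 0 : ℝ) : ℂ) := by
  ext ⟨r, q⟩ ⟨r', q'⟩
  have hcorner : (if q.1 < 2 ∧ q'.1 < 2 then M34 (r, q) (r', q') else 0) = 0 := by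
    rw [M34_apply]
    grind
  simp only [Omega34, of_apply, hcorner, sum_M34_apply, zero_add, diagonal_apply, Prod.mk.injEq]
  by_cases hr : r = r'
  · subst hr
    by_cases hq : q = q'
    · subst hq
      by_cases hr2 : 2 ≤ r.1 <;> by_cases hq2 : 2 ≤ q.1 <;> simp [hr2, hq2]
      norm_num
    · simp [hq]
  · simp [hr]

/-- **Appendix C of the paper:** the coherent information of `π₃₄` through the channel
`N` equals `-1`. -/
theorem coherent_info_pi34 :
    vNEntropy (chanN pi34) - vNEntropy Omega34 = -1 := by
  have hfour : Real.logb 2 4 = 2 := by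
    rw [show (4 : ℝ) = 2 ^ (2 : ℝ) by norm_num, Real.logb_rpow (by norm_num) (by norm_num)]
  rw [chanN_pi34, Omega34_eq_diagonal, vNEntropy_diagonal, vNEntropy_diagonal]
  simp [Fintype.sum_prod_type, Fin.sum_univ_four, Real.logb_inv, hfour]
  norm_num
end
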